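/- arXiv:0910.2429 — 4 statements merged into one kernel-verified Lean document; each statement's English description precedes it below -/
import Mathlib

section
/- Let Q be a uniquely 2-divisible right Bol loop in which every right inner mapping R_{x,y} = R_x R_y R_{xy}^{-1} is an automorphism of Q. Then the commutant C(Q) = {a in Q : ax = xa for all x in Q} is a normal subloop of Q. -/
/-- A loop: a set with multiplication and two-sided identity in which all left
and right translations are bijections. -/
class LoopStr (Q : Type*) extends Mul Q, One Q where
  one_mul : ∀ x : Q, 1 * x = x
  mul_one : ∀ x : Q, x * 1 = x
  bijL : ∀ a : Q, Function.Bijective fun x : Q => a * x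
  bijR : ∀ a : Q, Function.Bijective fun x : Q => x * a

/-- Right translation `R_a : x ↦ x * a` as a permutation. -/
noncomputable def Rt {Q : Type*} [LoopStr Q] (a : Q) : Equiv.Perm Q :=
  Equiv.ofBijective (fun x : Q => x * a) (LoopStr.bijR a)

/-- Left translation `L_a : x ↦ a * x` as a permutation. -/
noncomputable def Lt {Q : Type*} [LoopStr Q] (a : Q) : Equiv.Perm Q :=
  Equiv.ofBijective (fun x : Q => a * x) (LoopStr.bijL a)

/-- A right Bol loop. -/
class RightBolLoop (Q : Type*) extends LoopStr Q where
  bol : ∀ x y z : Q, ((x * y) * z) * y = x * ((y * z) * y)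

/-- Integer powers in a loop: `x ^ n = 1 R_x^n`. -/
noncomputable def zp {Q : Type*} [LoopStr Q] (x : Q) (n : ℤ) : Q := ((Rt x) ^ n) 1

/-- A subloop: contains `1`, closed under multiplication and under both divisions. -/
def IsSubloop {Q : Type*} [LoopStr Q] (S : Set Q) : Prop :=
  (1 : Q) ∈ S ∧ (∀ a ∈ S, ∀ b ∈ S, a * b ∈ S) ∧
  (∀ a ∈ S, ∀ b ∈ S, ∀ x : Q, a * x = b → x ∈ S) ∧
  (∀ a ∈ S, ∀ b ∈ S, ∀ x : Q, x * a = b → x ∈ S)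

/-- The multiplication group `Mlt(Q) = ⟨R_x, L_x : x ∈ Q⟩`. -/
def Mlt (Q : Type*) [LoopStr Q] : Subgroup (Equiv.Perm Q) :=
  Subgroup.closure {f : Equiv.Perm Q | ∃ a : Q, f = Rt a ∨ f = Lt a}

/-- A normal subloop: a subloop invariant under the inner mapping group,
the stabilizer of `1` in `Mlt(Q)`. -/
def IsNormalSubloop {Q : Type*} [LoopStr Q] (S : Set Q) : Prop :=
  IsSubloop S ∧ ∀ f ∈ Mlt Q, f 1 = 1 → ∀ a ∈ S, f a ∈ S


section GroupLemmas
variable {G : Type*} [Group G]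

theorem comm_of_pal {c s : G} (h1 : c * s * s * c = s * c * c * s)
    (h2 : c * s⁻¹ * s⁻¹ * c = s⁻¹ * c * c * s⁻¹) :
    c * (s * s * c * s⁻¹ * s⁻¹) = (s * s * c * s⁻¹ * s⁻¹) * c := by
  have e1 : (s⁻¹ * c * s) * (s * c * s⁻¹) = c * c := by
    have : (s⁻¹ * c * s) * (s * c * s⁻¹) = s⁻¹ * (c * s * s * c) * s⁻¹ := by group
    rw [this, h1]; group
  have e2 : (s * c * s⁻¹) * (s⁻¹ * c * s) = c * c := by
    have : (s * c * s⁻¹) * (s⁻¹ * c * s) = s * (c * s⁻¹ * s⁻¹ * c) * s := by group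
    rw [this, h2]; group
  have e3 := e1.trans e2.symm
  calc c * (s * s * c * s⁻¹ * s⁻¹) = s * ((s⁻¹ * c * s) * (s * c * s⁻¹)) * s⁻¹ := by group
    _ = s * ((s * c * s⁻¹) * (s⁻¹ * c * s)) * s⁻¹ := by rw [e3]
    _ = _ := by group

/-- the commutator is central -/
theorem comm_central {c t : G} (h1 : c * (t * c * t⁻¹) = (t * c * t⁻¹) * c)
    (h2 : c * t * t * c = t * c * c * t) :
    Commute (t * c * t⁻¹ * c⁻¹) c ∧ Commute (t * c * t⁻¹ * c⁻¹) t := by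
  constructor
  · show (t * c * t⁻¹ * c⁻¹) * c = c * (t * c * t⁻¹ * c⁻¹)
    calc _ = (t * c * t⁻¹) * c * c⁻¹ := by group
      _ = c * (t * c * t⁻¹) * c⁻¹ := by rw [h1]
      _ = _ := by group
  · show (t * c * t⁻¹ * c⁻¹) * t = t * (t * c * t⁻¹ * c⁻¹)
    -- both sides: t c t⁻¹ (c⁻¹ (t⁻¹ c t)) ...
    have e1 : (t⁻¹ * c * t) * (t * c * t⁻¹) = c * c := by
      have : (t⁻¹ * c * t) * (t * c * t⁻¹) = t⁻¹ * (c * t * t * c) * t⁻¹ := by group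
      rw [this, h2]; group
    have e2 : (t⁻¹ * c * t) * c = c * (t⁻¹ * c * t) := by
      calc (t⁻¹ * c * t) * c = t⁻¹ * (c * (t * c * t⁻¹)) * t := by group
        _ = t⁻¹ * ((t * c * t⁻¹) * c) * t := by rw [h1]
        _ = _ := by group
    have e3 : c * (t * c * t⁻¹ * c⁻¹) = (t⁻¹ * c * t)⁻¹ * c * c := by
      calc c * (t * c * t⁻¹ * c⁻¹) = (c * (t * c * t⁻¹)) * c⁻¹ := by group
        _ = t * c * t⁻¹ := by rw [h1]; group
        _ = (t⁻¹ * c * t)⁻¹ * ((t⁻¹ * c * t) * (t * c * t⁻¹)) := by group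
        _ = _ := by rw [e1]; group
    have e4 : t * c * t⁻¹ * c⁻¹ = (t⁻¹ * c * t)⁻¹ * c := by
      have h5 : c * (t⁻¹ * c * t)⁻¹ = (t⁻¹ * c * t)⁻¹ * c :=
        (Commute.inv_right (show Commute c (t⁻¹ * c * t) from e2.symm)).eq
      apply mul_left_cancel (a := c)
      rw [e3, ← mul_assoc c, h5]
    have e5 : t⁻¹ * (t * c * t⁻¹ * c⁻¹) * t = (t⁻¹ * c * t)⁻¹ * c := by
      have h5 : c * (t⁻¹ * c * t)⁻¹ = (t⁻¹ * c * t)⁻¹ * c :=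
        (Commute.inv_right (show Commute c (t⁻¹ * c * t) from e2.symm)).eq
      rw [← h5]; group
    calc _ = t * (t⁻¹ * (t * c * t⁻¹ * c⁻¹) * t) := by group
      _ = _ := by rw [e5, e4]

theorem final_rel {A T k : G} (hk : T * A = k * (A * T)) (hA : Commute k A) (hT : Commute k T) :
    A⁻¹ * (T * T) * A * A = k ^ 3 * (T * A * T) ∧
    (A⁻¹ * (T * T) * A * A = (T * T)⁻¹ * A * (T * T) * (T * T) → k ^ 6 = 1) := by
  have hTA : T * A * T = k * (A * T * T) := by rw [hk]; group
  have h2 : T * T * A = k ^ 2 * (A * T * T) := by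
    calc T * T * A = T * (T * A) := by group
      _ = (T * k) * (A * T) := by rw [hk]; group
      _ = k * (T * A) * T := by rw [← hT.eq]; group
      _ = _ := by rw [hk, pow_two]; group
  have h3 : A⁻¹ * (T * T) * A * A = k ^ 4 * (A * T * T) := by
    have hA2 : k ^ 2 * A⁻¹ = A⁻¹ * k ^ 2 := ((hA.pow_left 2).inv_right).eq
    have hA3 : k ^ 2 * A = A * k ^ 2 := ((hA.pow_left 2)).eq
    calc A⁻¹ * (T * T) * A * A = A⁻¹ * (T * T * A) * A := by group
      _ = A⁻¹ * (k ^ 2 * (A * T * T)) * A := by rw [h2]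
      _ = (A⁻¹ * k ^ 2) * A * (T * T * A) := by group
      _ = k ^ 2 * (T * T * A) := by rw [← hA2]; group
      _ = _ := by rw [h2]; group
  have hT2 : Commute (k ^ 2) (T * T) := (hT.pow_left 2).mul_right (hT.pow_left 2)
  have h4 : (T * T)⁻¹ * A * (T * T) * (T * T) = k⁻¹ ^ 2 * (A * T * T) := by
    have : k ^ 2 * ((T * T)⁻¹ * A * (T * T) * (T * T)) = A * T * T := by
      calc k ^ 2 * ((T * T)⁻¹ * A * (T * T) * (T * T))
          = (k ^ 2 * (T * T)⁻¹) * (A * T * T) * (T * T) := by group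
        _ = (T * T)⁻¹ * (k ^ 2 * (A * T * T)) * (T * T) := by
            rw [hT2.inv_right.eq]; group
        _ = _ := by rw [← h2]; group
    rw [← this]; group
  refine ⟨by rw [h3, hTA]; group, fun h => ?_⟩
  rw [h3, h4] at h
  have := mul_right_cancel h
  calc k ^ 6 = k ^ 2 * k ^ 4 := by group
    _ = 1 := by rw [this]; group

end GroupLemmas

section Bol
variable {Q : Type*} [RightBolLoop Q]

theorem perm_apply_inv {X : Type*} (f : Equiv.Perm X) (x : X) : f (f⁻¹ x) = x :=
  f.apply_symm_apply x

theorem Rt_apply (a x : Q) : Rt a x = x * a := rfl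
theorem Lt_apply (a x : Q) : Lt a x = a * x := rfl

theorem Rt_one_eq (a : Q) : Rt a 1 = a := LoopStr.one_mul a

theorem Rt_inj {a b : Q} (h : Rt a = Rt b) : a = b := by
  rw [← Rt_one_eq a, h, Rt_one_eq]

theorem Rt_one : Rt (1 : Q) = 1 := by
  ext x; exact LoopStr.mul_one x

theorem Rt_pal (y z : Q) : Rt y * Rt z * Rt y = Rt ((y * z) * y) := by
  ext x; exact RightBolLoop.bol x y z

theorem Rt_sq (y : Q) : Rt y * Rt y = Rt (y * y) := by
  have := Rt_pal y (1 : Q)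
  rwa [Rt_one, mul_one, LoopStr.mul_one] at this

theorem exists_inv (y : Q) : ∃ z : Q, Rt z = (Rt y)⁻¹ := by
  obtain ⟨z, hz⟩ := (LoopStr.bijL y).2 1
  refine ⟨z, ?_⟩
  have h := Rt_pal y z
  have hz' : y * z = 1 := hz
  rw [hz', LoopStr.one_mul] at h
  have : Rt y * Rt z = 1 := by
    have h2 : (Rt y * Rt z) * Rt y = 1 * Rt y := by rw [h, one_mul]
    exact mul_right_cancel h2
  exact (inv_eq_of_mul_eq_one_right this).symm

/-- loop automorphism predicate -/
def IsAut (f : Equiv.Perm Q) : Prop := ∀ a b : Q, f (a * b) = f a * f b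

theorem IsAut.mul {f g : Equiv.Perm Q} (hf : IsAut f) (hg : IsAut g) : IsAut (f * g) := by
  intro a b
  show f (g (a * b)) = f (g a) * f (g b)
  rw [hg, hf]

theorem IsAut.inv {f : Equiv.Perm Q} (hf : IsAut f) : IsAut f⁻¹ := by
  intro a b
  apply f.injective
  rw [hf]; simp

theorem IsAut.conj {f : Equiv.Perm Q} (hf : IsAut f) (x : Q) : f * Rt x * f⁻¹ = Rt (f x) := by
  ext y
  show f (f⁻¹ y * x) = y * f x
  rw [hf]; simp

/-- The commutant. -/
def Cm (Q : Type*) [RightBolLoop Q] : Set Q := {a : Q | ∀ x : Q, a * x = x * a}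

theorem IsAut.mem {f : Equiv.Perm Q} (hf : IsAut f) {a : Q} (ha : a ∈ Cm Q) : f a ∈ Cm Q := by
  intro x
  obtain ⟨y, rfl⟩ := f.surjective x
  rw [← hf, ← hf, ha]

theorem pal_left {c : Q} (hc : c ∈ Cm Q) (t : Q) :
    Rt t * Rt c * Rt t = Rt ((t * t) * c) := by
  rw [Rt_pal, ← hc t]
  congr 1
  rw [← hc (t * t)]
  rw [hc t, hc (t*t)]
  -- (t*c)*t = (t*t)*c
  have h := RightBolLoop.bol c t (1 : Q)
  rw [LoopStr.mul_one, LoopStr.mul_one] at h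
  rw [← hc t, h, hc]

theorem pal_right {c : Q} (hc : c ∈ Cm Q) (t : Q) :
    Rt c * Rt t * Rt c = Rt (t * (c * c)) := by
  rw [Rt_pal, hc t]
  congr 1
  have h := RightBolLoop.bol t c (1 : Q)
  rwa [LoopStr.mul_one, LoopStr.mul_one] at h

theorem sq_mem {c : Q} (hc : c ∈ Cm Q) : c * c ∈ Cm Q := by
  intro x
  have h := RightBolLoop.bol c c x
  have h1 : (c * x) * c = x * (c * c) := by
    have h := RightBolLoop.bol x c (1 : Q)
    rw [LoopStr.mul_one, LoopStr.mul_one] at h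
    rw [hc x, h]
  rw [h1, hc (x * (c * c))] at h
  exact (LoopStr.bijR c).1 h

theorem inv_mem {c d : Q} (hc : c ∈ Cm Q) (hd : Rt d = (Rt c)⁻¹) : d ∈ Cm Q := by
  have hdc : d * c = 1 := by
    have : Rt c (Rt d 1) = 1 := by rw [hd]; simp
    rwa [Rt_one_eq] at this
  intro x
  have key : ∀ z : Q, z * c = d * ((z * c) * c) := by
    intro z
    have h := RightBolLoop.bol d c z
    rwa [hdc, LoopStr.one_mul, hc z] at h
  have h := key (((x * d) * d))
  have e : ∀ u : Q, (u * d) * c = u := by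
    intro u
    show Rt c (Rt d u) = u
    rw [hd]; simp
  rw [e, e] at h
  exact h.symm

theorem pal_eq {c : Q} (hc : c ∈ Cm Q) (t : Q) :
    Rt c * Rt t * Rt t * Rt c = Rt t * Rt c * Rt c * Rt t := by
  have h1 := pal_left (sq_mem hc) t
  have h2 := pal_right hc (t * t)
  rw [← Rt_sq] at h1 h2
  rw [← mul_assoc] at h1 h2
  rw [h2, h1]

theorem sqrt_unique (hdiv : Function.Bijective fun x : Q => x * x) {x y : Q}
    (h : Rt x * Rt x = Rt y * Rt y) : x = y := by
  rw [Rt_sq, Rt_sq] at h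
  exact hdiv.1 (Rt_inj h)

theorem exists_sqrt (hdiv : Function.Bijective fun x : Q => x * x) (x : Q) :
    ∃ t : Q, t * t = x ∧ Rt t * Rt t = Rt x := by
  obtain ⟨t, ht⟩ := hdiv.2 x
  have ht' : t * t = x := ht
  exact ⟨t, ht', by rw [Rt_sq, ht']⟩

theorem central (hdiv : Function.Bijective fun x : Q => x * x) {c : Q} (hc : c ∈ Cm Q) (t : Q) :
    Commute (Rt t * Rt c * (Rt t)⁻¹ * (Rt c)⁻¹) (Rt c) ∧
    Commute (Rt t * Rt c * (Rt t)⁻¹ * (Rt c)⁻¹) (Rt t) := by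
  obtain ⟨s, -, hs⟩ := exists_sqrt hdiv t
  obtain ⟨s', hs'⟩ := exists_inv s
  refine comm_central ?_ (pal_eq hc t)
  have h := comm_of_pal (pal_eq hc s) (by rw [← hs']; exact pal_eq hc s')
  rw [← hs]
  simpa [mul_assoc] using h

/-- An involutory twist is trivial. -/
theorem twist_trivial (hdiv : Function.Bijective fun x : Q => x * x) {e : Q}
    {j : Equiv.Perm Q} (hj : IsAut j) (hj2 : ∀ x, j (j x) = x)
    (he : ∀ x, e * x = j x * e) (x : Q) : j x = x := by
  have jroot : ∀ t u : Q, t * t = u → j u = u → j t = t := by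
    intro t u h1 h2
    apply hdiv.1
    show j t * j t = t * t
    rw [← hj, h1, h2]
  have jinv : ∀ a b : Q, Rt a = (Rt b)⁻¹ → Rt (j a) = (Rt (j b))⁻¹ := by
    intro a b h
    rw [← hj.conj, ← hj.conj, h]; group
  obtain ⟨s, -, hs⟩ := exists_sqrt hdiv x
  obtain ⟨si, hsi⟩ := exists_inv s
  obtain ⟨q, -, hq⟩ := exists_sqrt hdiv ((si * j x) * si)
  obtain ⟨xi, hxi⟩ := exists_inv x
  -- midpoint
  set f := (s * q) * s with hf
  have hfR : Rt f = Rt s * Rt q * Rt s := (Rt_pal s q).symm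
  have hmid : Rt f * (Rt x)⁻¹ * Rt f = Rt (j x) := by
    rw [← Rt_pal, hsi] at hq
    rw [hfR, ← hs]
    calc _ = Rt s * (Rt q * Rt q) * Rt s := by group
      _ = _ := by rw [hq]; group
  have huniq : ∀ g : Q, Rt g * (Rt x)⁻¹ * Rt g = Rt (j x) → g = f := by
    intro g hg
    have h1 : (si * g) * si = (si * f) * si := by
      apply sqrt_unique hdiv
      rw [← Rt_pal, ← Rt_pal, hsi]
      calc _ = (Rt s)⁻¹ * (Rt g * (Rt s * Rt s)⁻¹ * Rt g) * (Rt s)⁻¹ := by group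
        _ = (Rt s)⁻¹ * (Rt f * (Rt s * Rt s)⁻¹ * Rt f) * (Rt s)⁻¹ := by rw [hs, hg, hmid]
        _ = _ := by group
    exact (LoopStr.bijL si).1 ((LoopStr.bijR si).1 h1)
  have hjf : j f = f := by
    apply huniq
    have h : j * (Rt f * (Rt x)⁻¹ * Rt f) * j⁻¹ = Rt x := by
      rw [hmid, hj.conj, hj2]
    have h' : Rt (j f) * (Rt (j x))⁻¹ * Rt (j f) = Rt x := by
      rw [← h, ← hj.conj, ← hj.conj]; group
    calc _ = Rt (j f) * (Rt (j f) * (Rt (j x))⁻¹ * Rt (j f))⁻¹ * Rt (j f) := by rw [h']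
      _ = _ := by group
  obtain ⟨g, hg0, hg⟩ := exists_sqrt hdiv f
  have hjg : j g = g := jroot g f hg0 hjf
  obtain ⟨gi, hgi⟩ := exists_inv g
  have hjgi : j gi = gi := by
    apply Rt_inj
    rw [jinv _ _ hgi, hjg, hgi]
  set a := (gi * x) * gi with ha
  have haR : Rt a = (Rt g)⁻¹ * Rt x * (Rt g)⁻¹ := by rw [ha, ← Rt_pal, hgi]
  have hja : Rt (j a) = (Rt a)⁻¹ := by
    have : j a = (gi * j x) * gi := by rw [ha, hj, hj, hjgi]
    rw [this, ← Rt_pal, haR, hgi, ← hmid, ← hg]; group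
  -- (a e) a = e
  have hae : (a * e) * a = e := by
    have h1 : a * e = e * j a := by rw [he, hj2]
    rw [h1]
    show Rt a (Rt (j a) e) = e
    rw [hja]; simp
  have haeR : Rt a * Rt e * Rt a = Rt e := by rw [Rt_pal, hae]
  obtain ⟨d, -, hd⟩ := exists_sqrt hdiv e
  have h1 : (d * a) * d = e := by
    apply sqrt_unique hdiv
    rw [← Rt_pal]
    calc _ = Rt d * (Rt a * (Rt d * Rt d) * Rt a) * Rt d := by group
      _ = Rt d * Rt e * Rt d := by rw [hd, haeR]
      _ = _ := by rw [← hd]; group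
  have h2 : Rt a = 1 := by
    have h3 : Rt d * Rt a * Rt d = Rt d * 1 * Rt d := by rw [Rt_pal, h1, ← hd]; group
    exact mul_left_cancel (mul_right_cancel h3)
  have hxf : x = f := by
    apply Rt_inj
    have : Rt x = Rt g * Rt a * Rt g := by rw [haR]; group
    rw [this, h2, ← hg]; group
  rw [hxf, hjf]

theorem Lt_prod {a b : Q} (ha : a ∈ Cm Q) (hb : b ∈ Cm Q) :
    Lt (b * a) = (Rt a)⁻¹ * Rt b * Rt a * Rt a := by
  ext x
  have h := RightBolLoop.bol b a x
  rw [ha x, hb ((x * a) * a)] at h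
  show (b * a) * x = (Rt a)⁻¹ (((x * a) * a) * b)
  rw [← h]
  exact ((Rt a).symm_apply_apply _).symm

section Aut

theorem step_aut (haut : ∀ x y : Q, IsAut ((Rt (x * y))⁻¹ * Rt y * Rt x))
    {g : Equiv.Perm Q} (z y : Q) (hg : IsAut ((Rt z)⁻¹ * g)) :
    IsAut ((Rt (z * y))⁻¹ * (Rt y * g)) := by
  have := (haut z y).mul hg
  convert this using 1
  group

theorem mul_mem_Cm (haut : ∀ x y : Q, IsAut ((Rt (x * y))⁻¹ * Rt y * Rt x))
    (hdiv : Function.Bijective fun x : Q => x * x) {a b : Q}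
    (ha : a ∈ Cm Q) (hb : b ∈ Cm Q) : b * a ∈ Cm Q := by
  obtain ⟨t, ht0, ht⟩ := exists_sqrt hdiv b
  obtain ⟨hA, hT⟩ := central hdiv ha t
  set k := Rt t * Rt a * (Rt t)⁻¹ * (Rt a)⁻¹ with hk
  have hkk : Rt t * Rt a = k * (Rt a * Rt t) := by
    have : Rt t * Rt a = k * Rt a * Rt t := by rw [hk]; group
    rw [this, mul_assoc]
  obtain ⟨r1, r2⟩ := final_rel hkk hA hT
  have e1 := Lt_prod ha hb
  have e2 := Lt_prod hb ha
  rw [ha b] at e2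
  have k6 : k ^ 6 = 1 := r2 (by rw [ht, ← e1, e2])
  rw [ht, ← e1, pal_left ha, ht0] at r1
  have hcomm : Commute k (Rt (b * a)) := by
    rw [← ht0, ← pal_left ha]
    exact (hT.mul_right hA).mul_right hT
  -- k is an automorphism
  obtain ⟨ai, hai⟩ := exists_inv a
  obtain ⟨ti, hti⟩ := exists_inv t
  have haiC : ai ∈ Cm Q := inv_mem ha hai
  have kaut : IsAut k := by
    have h0 : IsAut ((Rt (1 : Q))⁻¹ * 1) := by
      rw [Rt_one]; intro x y; simp
    have h := step_aut haut _ t (step_aut haut _ a (step_aut haut _ ti (step_aut haut _ ai h0)))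
    have hz : (((1 * ai) * ti) * a) * t = 1 := by
      rw [LoopStr.one_mul, haiC ti]
      show Rt t (Rt a (Rt ai ti)) = 1
      rw [hai]
      have : Rt t (Rt ti 1) = 1 := by rw [hti]; simp
      rw [Rt_one_eq] at this
      simpa using this
    rw [hz, Rt_one, hai, hti] at h
    convert h using 1
    rw [hk]; group
  have jaut : IsAut (k ^ 3) := by
    rw [pow_succ, pow_two]; exact (kaut.mul kaut).mul kaut
  have j2 : ∀ x, (k ^ 3) ((k ^ 3) x) = x := by
    intro x
    show (k ^ 3 * k ^ 3) x = x
    rw [← pow_add, k6]; rfl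
  have he : ∀ x, (b * a) * x = (k ^ 3) x * (b * a) := by
    intro x
    show Lt (b * a) x = (Rt (b * a) * k ^ 3) x
    rw [r1, (hcomm.pow_left 3).eq]
  intro x
  rw [he, twist_trivial hdiv jaut j2 he]

theorem subloop (haut : ∀ x y : Q, IsAut ((Rt (x * y))⁻¹ * Rt y * Rt x))
    (hdiv : Function.Bijective fun x : Q => x * x) : IsSubloop (Cm Q) := by
  have hd : ∀ a ∈ Cm Q, ∀ b ∈ Cm Q, ∀ x : Q, x * a = b → x ∈ Cm Q := by
    intro a ha b hb x h
    obtain ⟨ai, hai⟩ := exists_inv a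
    have : x = b * ai := by
      rw [← h]
      show x = Rt ai (Rt a x)
      rw [hai]; simp
    rw [this]
    exact mul_mem_Cm haut hdiv (inv_mem ha hai) hb
  refine ⟨fun x => ?_, fun a ha b hb => mul_mem_Cm haut hdiv hb ha, ?_, hd⟩
  · rw [LoopStr.one_mul, LoopStr.mul_one]
  · intro a ha b hb x h
    exact hd a ha b hb x (by rw [← ha, h])

theorem shift (haut : ∀ x y : Q, IsAut ((Rt (x * y))⁻¹ * Rt y * Rt x))
    {a : Q} (ha : a ∈ Cm Q) (x y : Q) :
    (x * a) * y = (x * y) * ((Rt (x * y))⁻¹ * Rt y * Rt x) a := by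
  rw [← ((haut x y).mem ha), ← ha x]
  show _ = Rt (x * y) ((Rt (x * y))⁻¹ ((a * x) * y))
  simp

theorem coset (haut : ∀ x y : Q, IsAut ((Rt (x * y))⁻¹ * Rt y * Rt x))
    (hdiv : Function.Bijective fun x : Q => x * x) {f : Equiv.Perm Q}
    (hf : f ∈ Mlt Q) : ∀ x y : Q, (∃ a ∈ Cm Q, y = x * a) ↔ (∃ a ∈ Cm Q, f y = f x * a) := by
  induction hf using Subgroup.closure_induction with
  | one => intro x y; rfl
  | mul f g _ _ ihf ihg => intro x y; rw [ihg, ihf]; rfl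
  | inv f _ ih =>
    intro x y
    rw [ih (f⁻¹ x) (f⁻¹ y)]; simp
  | mem f hf =>
    obtain ⟨c, rfl | rfl⟩ := hf
    · intro x y
      constructor
      · rintro ⟨a, ha, rfl⟩
        exact ⟨_, (haut x c).mem ha, shift haut ha x c⟩
      · rintro ⟨a, ha, h⟩
        refine ⟨_, ((haut x c).inv).mem ha, ?_⟩
        apply (Rt c).injective
        rw [h]
        have := shift haut (((haut x c).inv).mem ha) x c
        rw [perm_apply_inv] at this
        exact this.symm
    · intro x y
      obtain ⟨t, ht0, ht⟩ := exists_sqrt hdiv x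
      have key : ∀ a ∈ Cm Q, c * (x * a) =
          (c * x) * ((Rt ((c * t) * t))⁻¹ * Rt t * Rt (c * t)) a := by
        intro a ha
        have h1 : c * (x * a) = ((c * t) * a) * t := by
          show Rt (x * a) c = (Rt t * Rt a * Rt t) c
          rw [pal_left ha, ht0]
        have h2 : (c * t) * t = c * x := by
          show (Rt t * Rt t) c = Rt x c
          rw [ht]
        rw [h1, shift haut ha, h2]
      constructor
      · rintro ⟨a, ha, rfl⟩
        exact ⟨_, (haut (c * t) t).mem ha, key a ha⟩
      · rintro ⟨a, ha, h⟩
        refine ⟨_, ((haut (c * t) t).inv).mem ha, ?_⟩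
        apply (Lt c).injective
        rw [h]
        have := key _ (((haut (c * t) t).inv).mem ha)
        rw [perm_apply_inv] at this
        exact this.symm

end Aut
end Bol

/-- In a uniquely 2-divisible right Bol loop in which every right inner
mapping `R_{x,y} = R_x R_y R_{xy}⁻¹` is an automorphism, the commutant
`C(Q)` is a normal subloop. -/
theorem commutant_isNormalSubloop {Q : Type*} [RightBolLoop Q]
    (hdiv : Function.Bijective fun x : Q => x * x)
    (haut : ∀ x y a b : Q,
      ((Rt (x * y))⁻¹ * Rt y * Rt x) (a * b) =
        ((Rt (x * y))⁻¹ * Rt y * Rt x) a * ((Rt (x * y))⁻¹ * Rt y * Rt x) b) :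
    IsNormalSubloop {a : Q | ∀ x : Q, a * x = x * a} := by
  have ha : ∀ x y : Q, IsAut ((Rt (x * y))⁻¹ * Rt y * Rt x) := haut
  refine ⟨subloop ha hdiv, fun f hf h1 a haC => ?_⟩
  obtain ⟨b, hb, h⟩ := (coset ha hdiv hf 1 a).1 ⟨a, haC, (LoopStr.one_mul a).symm⟩
  rw [h, h1, LoopStr.one_mul]
  exact hb
end

section
/- If Q is a uniquely 2-divisible Bruck loop, then the commutant C(Q) = {a in Q : ax = xa for all x in Q} is a normal subloop of Q. -/
/-- A Bruck loop: a right Bol loop with two-sided inverses satisfying the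
automorphic inverse property `(xy)⁻¹ = x⁻¹ y⁻¹`. -/
class BruckLoop (Q : Type*) extends RightBolLoop Q, Inv Q where
  mul_inv : ∀ x : Q, x * x⁻¹ = 1
  inv_mul : ∀ x : Q, x⁻¹ * x = 1
  aip : ∀ x y : Q, (x * y)⁻¹ = x⁻¹ * y⁻¹

namespace BruckAux

set_option linter.unusedSimpArgs false

open LoopStr RightBolLoop BruckLoop

variable {Q : Type*} [BruckLoop Q]

theorem rcancel {x y a : Q} (h : x * a = y * a) : x = y := (bijR a).1 h

theorem lcancel {x y a : Q} (h : a * x = a * y) : x = y := (bijL a).1 h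

theorem Rt_apply (a x : Q) : Rt a x = x * a := rfl

theorem Rt_one_app (a : Q) : Rt a (1 : Q) = a := LoopStr.one_mul a

theorem Rt_inj {a b : Q} (h : Rt a = Rt b) : a = b := by
  have := congrArg (fun f : Equiv.Perm Q => f 1) h
  simpa only [Rt_one_app] using this

theorem Rt_one : Rt (1 : Q) = 1 := by
  ext x; exact LoopStr.mul_one x

theorem rip (x y : Q) : (x * y) * y⁻¹ = x := by
  apply rcancel (a := y)
  rw [bol, BruckLoop.mul_inv, LoopStr.one_mul]

theorem inv_inv' (x : Q) : x⁻¹⁻¹ = x := by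
  apply lcancel (a := x⁻¹)
  rw [BruckLoop.mul_inv, BruckLoop.inv_mul]

theorem one_inv : (1 : Q)⁻¹ = 1 := by
  have := BruckLoop.mul_inv (1 : Q)
  rwa [LoopStr.one_mul] at this

theorem Rt_inv (x : Q) : Rt x⁻¹ = (Rt x)⁻¹ := by
  rw [eq_inv_iff_mul_eq_one]
  ext y; exact rip y x

theorem Rt_bol (y z : Q) : Rt y * Rt z * Rt y = Rt ((y * z) * y) := by
  ext x; exact bol x y z

theorem Rt_sq (y : Q) : Rt y * Rt y = Rt (y * y) := by
  have := Rt_bol y 1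
  rwa [Rt_one, _root_.mul_one, LoopStr.mul_one] at this

/-- inversion as a permutation -/
noncomputable def J : Equiv.Perm Q :=
  ⟨fun x => x⁻¹, fun x => x⁻¹, inv_inv', inv_inv'⟩

theorem J_apply (x : Q) : J x = x⁻¹ := rfl

theorem JJ : (J : Equiv.Perm Q) * J = 1 := by
  ext x; exact inv_inv' x

theorem J_Rt (x : Q) : J * Rt x * J = (Rt x)⁻¹ := by
  rw [← Rt_inv]
  ext y
  change (y⁻¹ * x)⁻¹ = y * x⁻¹
  rw [aip, inv_inv']

/-- automorphisms -/
def Au (g : Equiv.Perm Q) : Prop := ∀ x, g * Rt x = Rt (g x) * g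

theorem Au.map_mul {g : Equiv.Perm Q} (h : Au g) (x y : Q) : g (x * y) = g x * g y :=
  congrArg (fun f : Equiv.Perm Q => f x) (h y)

theorem Au.map_one {g : Equiv.Perm Q} (h : Au g) : g 1 = 1 := by
  have := h.map_mul 1 1
  rw [LoopStr.one_mul] at this
  apply rcancel (a := g 1)
  rw [← this, LoopStr.one_mul]

theorem Au.map_inv {g : Equiv.Perm Q} (h : Au g) (x : Q) : g x⁻¹ = (g x)⁻¹ := by
  apply rcancel (a := g x)
  rw [← h.map_mul, BruckLoop.inv_mul, BruckLoop.inv_mul, h.map_one]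

theorem Au.mul {g k : Equiv.Perm Q} (h : Au g) (h' : Au k) : Au (g * k) := by
  intro x
  rw [mul_assoc, h' x, ← mul_assoc, h, mul_assoc]; rfl

theorem Au.inv {g : Equiv.Perm Q} (h : Au g) : Au g⁻¹ := by
  intro x
  have := h (g⁻¹ x)
  rw [show g (g⁻¹ x) = x from g.apply_symm_apply x] at this
  rw [inv_mul_eq_iff_eq_mul, ← mul_assoc, this, mul_inv_cancel_right]

theorem Au.J {g : Equiv.Perm Q} (h : Au g) : J * g * J = g := by
  ext x
  change (g x⁻¹)⁻¹ = g x
  rw [h.map_inv, inv_inv']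

theorem Au.comm {g : Equiv.Perm Q} (h : Au g) {x : Q} (hx : g x = x) : g * Rt x = Rt x * g := by
  rw [h x, hx]

theorem Au.fix {g : Equiv.Perm Q} (h : Au g) {x : Q} (hx : g * Rt x = Rt x * g) : g x = x := by
  rw [h x] at hx
  exact Rt_inj (mul_right_cancel hx)

/-- `t` is the reverse of the word `g`. -/
def Tr (g t : Equiv.Perm Q) : Prop :=
  (∀ z, ∃ w, g * Rt z * t = Rt w) ∧ (∀ z, ∃ w, t * Rt z * g = Rt w) ∧ J * g * J * t = 1

theorem Tr_Rt (x : Q) : Tr (Rt x) (Rt x) :=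
  ⟨fun z => ⟨_, Rt_bol x z⟩, fun z => ⟨_, Rt_bol x z⟩, by rw [J_Rt]; simp⟩

theorem Tr_Rt_inv (x : Q) : Tr (Rt x)⁻¹ (Rt x)⁻¹ := by
  rw [← Rt_inv]; exact Tr_Rt _

theorem Tr.mul {g t g' t' : Equiv.Perm Q} (h : Tr g t) (h' : Tr g' t') :
    Tr (g * g') (t' * t) := by
  refine ⟨fun z => ?_, fun z => ?_, ?_⟩
  · obtain ⟨w, hw⟩ := h'.1 z
    obtain ⟨v, hv⟩ := h.1 w
    refine ⟨v, ?_⟩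
    rw [← hv, ← hw]; group
  · obtain ⟨w, hw⟩ := h.2.1 z
    obtain ⟨v, hv⟩ := h'.2.1 w
    refine ⟨v, ?_⟩
    rw [← hv, ← hw]; group
  · have h1 := h.2.2
    have h2 := h'.2.2
    have : J * (g * g') * J * (t' * t) = (J * g) * (J * J) * (g' * J * t' * t) := by
      rw [JJ]; group
    rw [this]
    have : (J * g) * (J * J) * (g' * J * t' * t) = (J * g * J) * (J * g' * J * t') * t := by group
    rw [this, h2, _root_.mul_one, h1]

theorem Tr.inv_eq {g t : Equiv.Perm Q} (h : Tr g t) (h1 : g 1 = 1) : t = g⁻¹ := by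
  have h2 : t * g = 1 := by
    obtain ⟨w, hw⟩ := h.2.1 1
    rw [Rt_one, _root_.mul_one] at hw
    have e : t = (J * g * J)⁻¹ := eq_inv_of_mul_eq_one_right h.2.2
    have e1 : ((J : Equiv.Perm Q) * g * J : Equiv.Perm Q) (1 : Q) = 1 := by
      change (g (1 : Q)⁻¹)⁻¹ = 1
      rw [one_inv, h1, one_inv]
    have e2 : t 1 = 1 := by
      rw [e, Equiv.Perm.inv_eq_iff_eq, e1]
    have : (t * g) 1 = w := by rw [hw, Rt_one_app]
    rw [Equiv.Perm.mul_apply, h1, e2] at this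
    rw [hw, ← this, Rt_one]
  exact eq_inv_of_mul_eq_one_left h2

theorem Tr.au {g t : Equiv.Perm Q} (h : Tr g t) (h1 : g 1 = 1) : Au g := by
  intro x
  obtain ⟨w, hw⟩ := h.1 x
  rw [h.inv_eq h1] at hw
  have : (g * Rt x * g⁻¹) 1 = w := by rw [hw, Rt_one_app]
  have e : g⁻¹ 1 = 1 := by rw [Equiv.Perm.inv_eq_iff_eq, h1]
  rw [Equiv.Perm.mul_apply, Equiv.Perm.mul_apply, e, Rt_one_app] at this
  rw [this, ← hw]; group

/-- the square of a product -/
theorem sq_mul (c x : Q) : Rt (c * x) * Rt (c * x) = Rt x * Rt c * Rt c * Rt x := by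
  have T := (Tr_Rt_inv (c * x)).mul ((Tr_Rt x).mul (Tr_Rt c))
  have h1 : ((Rt (c * x))⁻¹ * (Rt x * Rt c)) 1 = 1 := by
    rw [Equiv.Perm.mul_apply, Equiv.Perm.mul_apply, Equiv.Perm.inv_eq_iff_eq, Rt_one_app,
      Rt_one_app]; rfl
  have := T.inv_eq h1
  have h2 : Rt c * Rt x = (Rt x * Rt c)⁻¹ * Rt (c * x) * Rt (c * x) := by
    rw [← mul_inv_eq_iff_eq_mul, this]; group
  calc _ = (Rt x * Rt c) * ((Rt x * Rt c)⁻¹ * Rt (c * x) * Rt (c * x)) := by group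
    _ = _ := by rw [← h2]; group

/-- commutant -/
def C (a : Q) : Prop := ∀ x : Q, a * x = x * a

theorem C.inv {a : Q} (h : C a) : C a⁻¹ := by
  intro x
  have := congrArg (fun z => z⁻¹) (h x⁻¹)
  simpa only [aip, inv_inv'] using this

theorem C.map {a : Q} (h : C a) {g : Equiv.Perm Q} (hg : Au g) : C (g a) := by
  intro x
  have := congrArg g (h (g⁻¹ x))
  simpa only [hg.map_mul, show g (g⁻¹ x) = x from g.apply_symm_apply x] using this

noncomputable def cm (a x : Q) : Equiv.Perm Q := Rt a * Rt x * (Rt a)⁻¹ * (Rt x)⁻¹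

theorem C.au0 {a : Q} (h : C a) (x : Q) : Au ((Rt a)⁻¹ * (Rt x)⁻¹ * Rt a * Rt x) := by
  apply ((((Tr_Rt_inv a).mul (Tr_Rt_inv x)).mul (Tr_Rt a)).mul (Tr_Rt x)).au
  simp only [Equiv.Perm.mul_apply, Equiv.Perm.inv_eq_iff_eq, Rt_one_app]
  exact (h x).symm

theorem C.au {a : Q} (h : C a) (x : Q) : Au (cm a x) := by
  have := h.inv.au0 x⁻¹
  simpa only [Rt_inv, inv_inv, cm] using this

theorem sq_inj (hdiv : Function.Bijective fun x : Q => x * x) {x y : Q}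
    (h : Rt x * Rt x = Rt y * Rt y) : x = y := by
  rw [Rt_sq, Rt_sq] at h
  exact hdiv.1 (Rt_inj h)

theorem comm_aux (hdiv : Function.Bijective fun x : Q => x * x) {g : Equiv.Perm Q} (x : Q)
    (h : Au g) (h' : Au ((Rt x)⁻¹ * g * Rt x)) : g x = x := by
  have e := h'.J
  have e2 : J * ((Rt x)⁻¹ * g * Rt x) * J = Rt x * g * (Rt x)⁻¹ := by
    have e3 := J_Rt x
    have e4 : J * (Rt x)⁻¹ * J = Rt x := by
      rw [← Rt_inv, J_Rt, Rt_inv, inv_inv]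
    calc _ = J * (Rt x)⁻¹ * 1 * g * 1 * Rt x * J := by group
      _ = (J * (Rt x)⁻¹ * J) * (J * g * J) * (J * Rt x * J) := by rw [← JJ]; group
      _ = _ := by rw [e3, e4, h.J]
  rw [e2] at e
  apply sq_inj hdiv
  have e5 : Rt (g x) = g * Rt x * g⁻¹ := by rw [h x]; group
  have e6 : g * Rt x * Rt x = Rt x * Rt x * g := by
    calc g * Rt x * Rt x = Rt x * ((Rt x)⁻¹ * g * Rt x) * Rt x := by group
      _ = _ := by rw [← e]; group
  calc Rt (g x) * Rt (g x) = g * Rt x * Rt x * g⁻¹ := by rw [e5]; group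
    _ = _ := by rw [e6]; group

theorem C.fix_r (hdiv : Function.Bijective fun x : Q => x * x) {a : Q} (h : C a) (x : Q) :
    cm a x x = x := by
  apply comm_aux hdiv x (h.au x)
  have := (h.inv.au0 x).inv
  rw [Rt_inv] at this
  convert this using 1
  simp only [cm]; group

theorem C.fix_l (hdiv : Function.Bijective fun x : Q => x * x) {a : Q} (h : C a) (x : Q) :
    cm a x a = a := by
  apply comm_aux hdiv a (h.au x)
  have := (h.au0 x⁻¹).inv
  rw [Rt_inv] at this
  convert this using 1
  simp only [cm]; group

theorem cm_eq (a x : Q) : Rt a * Rt x = cm a x * (Rt x * Rt a) := by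
  simp only [cm]; group

theorem asc {G : Type*} [Group G] {a b c : G} (h : a * b = c) (z : G) : a * (b * z) = c * z := by
  rw [← mul_assoc, h]

theorem g1 {G : Type*} [Group G] {A U r : G} (h : A * U = r * (U * A)) (h1 : r * U = U * r)
    (h2 : r * A = A * r) :
    (U * A * U) * (U * A * U) * (r * r) = A * (U * U) * A * (U * U) ∧
    A * (U * U) = (r * r) * ((U * U) * A) := by
  constructor <;>
  simp only [mul_assoc, h, asc h, ← h1, ← h2, asc h1.symm, asc h2.symm]

theorem g2 {G : Type*} [Group G] {A X T l t : G} (hT : T * T = X * A * X)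
    (h : A * T = t * (T * A)) (h1 : t * T = T * t) (h2 : t * A = A * t)
    (k : A * X = l * (X * A)) (k1 : l * X = X * l) (k2 : l * A = A * l) :
    (T * X⁻¹ * T) * (T * X⁻¹ * T) * t = A * X * A * X ∧ t * t = l * l := by
  constructor
  · calc (T * X⁻¹ * T) * (T * X⁻¹ * T) * t = T * X⁻¹ * (T * T) * X⁻¹ * T * t := by group
      _ = T * A * (T * t) := by rw [hT]; group
      _ = (T * t) * A * T := by
        rw [mul_assoc T t A, h2, ← h1]; group
      _ = t * (T * A) * T := by rw [← h1]; group
      _ = A * (T * T) := by rw [← h]; group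
      _ = _ := by rw [hT]; group
  · have e1 : A * (T * T) = (t * t) * (T * T) * A := by
      simp only [mul_assoc, h, asc h, ← h1, ← h2, asc h1.symm, asc h2.symm]
    have e2 : A * (X * A * X) = (l * l) * (X * A * X) * A := by
      simp only [mul_assoc, k, asc k, ← k1, ← k2, asc k1.symm, asc k2.symm]
    rw [hT, e2] at e1
    exact (mul_right_cancel (mul_right_cancel e1)).symm

theorem g3 {G : Type*} [Group G] {A X P Y l t : G} (hY : Y * t = A * X * A * X)
    (hP : P * l = A * X * A * X)
    (h1 : t * X = X * t) (h2 : t * A = A * t) (k1 : l * X = X * l) (k2 : l * A = A * l)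
    (e : t * t = l * l) : Y * Y = P * P := by
  have c1 : t * (A * X * A * X) = (A * X * A * X) * t := by
    simp only [mul_assoc, ← h1, ← h2, asc h1.symm, asc h2.symm]
  have c2 : l * (A * X * A * X) = (A * X * A * X) * l := by
    simp only [mul_assoc, ← k1, ← k2, asc k1.symm, asc k2.symm]
  have d1 : Y * Y * (t * t) = (A * X * A * X) * (A * X * A * X) := by
    have : t * Y = Y * t := by
      rw [← hY] at c1
      have := c1
      rw [← mul_assoc] at this
      exact mul_right_cancel this
    calc _ = Y * (Y * t) * t := by group
      _ = Y * (t * Y) * t := by rw [this]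
      _ = (Y * t) * (Y * t) := by group
      _ = _ := by rw [hY]
  have d2 : P * P * (l * l) = (A * X * A * X) * (A * X * A * X) := by
    have : l * P = P * l := by
      rw [← hP] at c2
      have := c2
      rw [← mul_assoc] at this
      exact mul_right_cancel this
    calc _ = P * (P * l) * l := by group
      _ = P * (l * P) * l := by rw [this]
      _ = (P * l) * (P * l) := by group
      _ = _ := by rw [hP]
  rw [← d2, e] at d1
  exact mul_right_cancel d1

/-- the commutant is closed under square roots -/
theorem C.root (hdiv : Function.Bijective fun x : Q => x * x) {c : Q} (h : C (c * c)) : C c := by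
  intro u
  set a := c * c with ha
  set x := u * u with hx
  set t := c * x with ht
  have hA : Rt a = Rt c * Rt c := (Rt_sq c).symm
  have hX : Rt x = Rt u * Rt u := (Rt_sq u).symm
  have hT : Rt t * Rt t = Rt x * Rt a * Rt x := by rw [sq_mul, hA]; group
  obtain ⟨p1, p2⟩ := g1 (cm_eq a u) ((h.au u).comm (h.fix_r hdiv u)) ((h.au u).comm (h.fix_l hdiv u))
  have hl : cm a x = cm a u * cm a u := by
    rw [← hX, cm_eq a x] at p2
    exact mul_right_cancel p2
  rw [← hl, ← hX] at p1
  obtain ⟨q1, q2⟩ := g2 hT (cm_eq a t) ((h.au t).comm (h.fix_r hdiv t))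
    ((h.au t).comm (h.fix_l hdiv t)) (cm_eq a x) ((h.au x).comm (h.fix_r hdiv x))
    ((h.au x).comm (h.fix_l hdiv x))
  have hA' : cm a t * Rt a = Rt a * cm a t := (h.au t).comm (h.fix_l hdiv t)
  have hT' : cm a t * Rt t = Rt t * cm a t := (h.au t).comm (h.fix_r hdiv t)
  have ftx : cm a t x = x := by
    have f1 : cm a t * (Rt x * Rt a * Rt x) = (Rt x * Rt a * Rt x) * cm a t := by
      rw [← hT, ← mul_assoc, hT', mul_assoc, hT', mul_assoc]
    set w := cm a t x with hw
    have f2 : Rt w * Rt a * Rt w = Rt x * Rt a * Rt x := by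
      have hW : cm a t * Rt x = Rt w * cm a t := (h.au t) x
      have : Rt w * Rt a * Rt w * cm a t = Rt x * Rt a * Rt x * cm a t := by
        rw [← f1, mul_assoc, ← hW]
        rw [mul_assoc, ← mul_assoc (Rt a), ← hA', ← mul_assoc, ← mul_assoc, ← hW]
        group
      exact mul_right_cancel this
    have f3 : Rt c * Rt w * Rt c = Rt c * Rt x * Rt c := by
      rw [Rt_bol, Rt_bol]
      congr 1
      apply sq_inj hdiv
      rw [← Rt_bol, ← Rt_bol]
      calc _ = Rt c * (Rt w * (Rt c * Rt c) * Rt w) * Rt c := by group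
        _ = Rt c * (Rt x * (Rt c * Rt c) * Rt x) * Rt c := by rw [← hA, f2]
        _ = _ := by group
    exact Rt_inj (mul_left_cancel (mul_right_cancel f3))
  have hX' := (h.au t).comm ftx
  have key := g3 q1 p1 hX' hA' ((h.au x).comm (h.fix_r hdiv x))
    ((h.au x).comm (h.fix_l hdiv x)) q2
  have key2 : Rt t * (Rt x)⁻¹ * Rt t = Rt u * Rt a * Rt u := by
    rw [← Rt_inv, Rt_bol, Rt_bol] at key ⊢
    rw [Rt_sq (t * x⁻¹ * t), Rt_sq (u * a * u)] at key
    exact congrArg Rt (hdiv.1 (sq_inj hdiv key))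
  have key3 : (Rt u)⁻¹ * Rt t * (Rt u)⁻¹ = Rt c := by
    rw [← Rt_inv, Rt_bol]
    congr 1
    apply sq_inj hdiv
    rw [← Rt_bol, ← hA, Rt_inv]
    calc _ = (Rt u)⁻¹ * (Rt t * (Rt u * Rt u)⁻¹ * Rt t) * (Rt u)⁻¹ := by group
      _ = _ := by rw [← hX, key2]; group
  have key4 : Rt t = Rt u * Rt c * Rt u := by rw [← key3]; group
  rw [Rt_bol] at key4
  have key5 := Rt_inj key4
  have key6 : t = (c * u) * u := by
    rw [ht, hx]
    exact congrArg (fun f : Equiv.Perm Q => f c) hX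
  rw [key6] at key5
  exact rcancel key5

theorem C.sq (hdiv : Function.Bijective fun x : Q => x * x) {b : Q} (h : C b) : C (b * b) := by
  intro x
  have e := cm_eq b x
  have k1 := (h.au x).comm (h.fix_r hdiv x)
  have k2 := (h.au x).comm (h.fix_l hdiv x)
  have : (Rt b * Rt b) * Rt x = Rt x * (Rt b * Rt b) * (cm b x * cm b x) := by
    simp only [mul_assoc, e, asc e, ← k1, ← k2, asc k1.symm, asc k2.symm]
  have := congrArg (fun f : Equiv.Perm Q => f 1) this
  rw [Rt_sq] at this
  simp only [Equiv.Perm.mul_apply, Rt_one_app, (h.au x).map_one] at this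
  exact this.symm

theorem cm_sq (hdiv : Function.Bijective fun x : Q => x * x) {b : Q} (h : C b) (x : Q) :
    cm (b * b) x = cm b x * cm b x := by
  have e := cm_eq b x
  have k1 := (h.au x).comm (h.fix_r hdiv x)
  have k2 := (h.au x).comm (h.fix_l hdiv x)
  have : (Rt b * Rt b) * Rt x = (cm b x * cm b x) * (Rt x * (Rt b * Rt b)) := by
    simp only [mul_assoc, e, asc e, ← k1, ← k2, asc k1.symm, asc k2.symm]
  rw [Rt_sq, cm_eq] at this
  exact mul_right_cancel this

theorem cm_inv (hdiv : Function.Bijective fun x : Q => x * x) {b : Q} (h : C b) (x : Q) :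
    cm b⁻¹ x = (cm b x)⁻¹ := by
  have e := cm_eq b x
  have k2 := (h.au x).comm (h.fix_l hdiv x)
  have : (Rt b)⁻¹ * Rt x = (cm b x)⁻¹ * (Rt x * (Rt b)⁻¹) := by
    have : Rt x = (Rt b)⁻¹ * cm b x * (Rt x * Rt b) := by
      rw [mul_assoc, ← e]; group
    have e3 : (Rt b)⁻¹ * cm b x = cm b x * (Rt b)⁻¹ := by
      rw [inv_mul_eq_iff_eq_mul, ← mul_assoc, ← k2]; group
    rw [e3] at this
    have e4 : Rt x * (Rt b)⁻¹ = cm b x * (Rt b)⁻¹ * Rt x := by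
      rw [mul_inv_eq_iff_eq_mul, mul_assoc]; exact this
    rw [e4]; group
  rw [← Rt_inv, cm_eq] at this
  exact mul_right_cancel this

/-- polarization -/
theorem pol1 (hdiv : Function.Bijective fun x : Q => x * x) {a : Q} (h : C a) (b x : Q) :
    cm a b (cm a x (b * x)) = b * x := by
  -- with `p = (b x) b`
  have hp := h.au ((b * x) * b)
  have e1 := cm_eq a b
  have e2 := cm_eq a x
  have e3 := cm_eq a ((b * x) * b)
  have k1 := (h.au ((b * x) * b)).comm (h.fix_r hdiv ((b * x) * b))
  have l1 := (h.au x).comm (h.fix_r hdiv x)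
  have m1 := (h.au b).comm (h.fix_r hdiv b)
  rw [← mul_assoc, k1, ← Rt_bol] at e3
  have : Rt b * Rt x * Rt b * cm a (b * x * b) = Rt b * (cm a b * cm a x * Rt x * Rt b) * cm a b := by
    have : Rt b * Rt x * Rt b * cm a (b * x * b) * Rt a =
      Rt b * (cm a b * cm a x * Rt x * Rt b) * cm a b * Rt a := by
      rw [← e3]
      simp only [mul_assoc, e1, asc e1, e2, asc e2, ← m1, asc m1.symm, asc l1.symm]
    exact mul_right_cancel this
  have := congrArg (fun f : Equiv.Perm Q => f 1) this
  simp only [Equiv.Perm.mul_apply, Rt_one_app, hp.map_one, (h.au b).map_one] at this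
  have := (Rt b).injective this
  simp only [Rt_apply] at this
  exact this.symm

theorem pol2 (hdiv : Function.Bijective fun x : Q => x * x) {a b : Q} (h : C a) (hb : C b) (x : Q) :
    (cm a x)⁻¹ (b * x) = (cm a b)⁻¹ ((cm a b)⁻¹ (b * x)) := by
  have e1 := cm_eq a b
  have e2 := cm_eq a x
  have l1 := (h.au x).comm (h.fix_r hdiv x)
  have l2 := (h.au x).comm (h.fix_l hdiv x)
  have m1 := (h.au b).comm (h.fix_r hdiv b)
  have m2 := (h.au b).comm (h.fix_l hdiv b)
  have E := hb ((a * x) * a)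
  have E1 : Rt a * Rt x * Rt a = Rt a * Rt a * (Rt x * (cm a x)⁻¹) := by
    rw [← mul_assoc, eq_mul_inv_iff_mul_eq]
    simp only [mul_assoc, e2, ← l2, ← l1, asc l2.symm, asc l1.symm, asc e2]
  have E2 : Rt b * (Rt a * Rt a) = Rt a * Rt a * ((cm a b)⁻¹ * (cm a b)⁻¹ * Rt b) := by
    have : Rt a * Rt a * Rt b = (cm a b * cm a b) * (Rt b * (Rt a * Rt a)) := by
      simp only [mul_assoc, e1, ← m2, ← m1, asc m2.symm, asc m1.symm, asc e1]
    have k : (cm a b)⁻¹ * Rt a = Rt a * (cm a b)⁻¹ := by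
      rw [inv_mul_eq_iff_eq_mul, ← mul_assoc, m2]; group
    calc _ = (cm a b)⁻¹ * (cm a b)⁻¹ * (Rt a * Rt a * Rt b) := by rw [this]; group
      _ = _ := by simp only [mul_assoc, k, asc k]
  have E3 : (Rt a * Rt x * Rt a) b = (Rt b * (Rt a * Rt a)) x := by
    rw [Rt_bol]
    have : (Rt a * Rt a) x = (a * x) * a := by
      change (x * a) * a = _
      rw [h x]
    rw [Equiv.Perm.mul_apply (Rt b), this]
    exact E
  rw [E1, E2] at E3
  have E4 := (Rt a * Rt a).injective E3
  have l3 : (cm a x)⁻¹ * Rt x = Rt x * (cm a x)⁻¹ := by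
    rw [inv_mul_eq_iff_eq_mul, ← mul_assoc, l1]; group
  have E5 : (cm a x)⁻¹ (b * x) = (Rt x * (cm a x)⁻¹) b := by rw [← l3]; rfl
  rw [E5, E4, hb x]; rfl

theorem cube (hdiv : Function.Bijective fun x : Q => x * x) {a b : Q} (h : C a) (hb : C b) (x : Q) :
    cm a b (cm a b (cm a b x)) = x := by
  have h1 := pol1 hdiv h.inv b x
  rw [cm_inv hdiv h, cm_inv hdiv h, pol2 hdiv h hb x] at h1
  have h2 : b * x = cm a b (cm a b (cm a b (b * x))) := by
    rw [Equiv.Perm.inv_eq_iff_eq, Equiv.Perm.inv_eq_iff_eq, Equiv.Perm.inv_eq_iff_eq] at h1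
    exact h1
  simp only [(h.au b).map_mul, h.fix_r hdiv b] at h2
  exact (lcancel h2).symm

theorem cube2 (hdiv : Function.Bijective fun x : Q => x * x) {a b : Q} (h : C a) (hb : C b) (x : Q) :
    cm b x (cm b x (cm b x a)) = a := by
  have h1 := pol1 hdiv hb.inv a x
  have h2 := pol1 hdiv (hb.sq hdiv) a x
  rw [cm_inv hdiv hb, cm_inv hdiv hb, Equiv.Perm.inv_eq_iff_eq, Equiv.Perm.inv_eq_iff_eq] at h1
  rw [cm_sq hdiv hb, cm_sq hdiv hb] at h2
  simp only [Equiv.Perm.mul_apply] at h2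
  have h3 : cm b x (cm b x (cm b x (a * x))) = a * x := by
    have h4 : cm b x (cm b x (a * x)) = cm b a (a * x) := by
      apply (cm b a).injective
      apply (cm b a).injective
      rw [h2, cube hdiv hb h]
    rw [h4, ← h1]
  simp only [(hb.au x).map_mul, hb.fix_r hdiv x] at h3
  exact rcancel h3

theorem ralt (x y : Q) : (x * y) * y = x * (y * y) :=
  congrArg (fun f : Equiv.Perm Q => f x) (Rt_sq y)

theorem C.mul (hdiv : Function.Bijective fun x : Q => x * x) {a b : Q} (ha : C a) (hb : C b) :
    C (a * b) := by
  obtain ⟨d, rfl⟩ := hdiv.2 b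
  have hd : C d := C.root hdiv hb
  intro x
  obtain ⟨u, rfl⟩ := hdiv.2 x
  show (a * (d * d)) * (u * u) = (u * u) * (a * (d * d))
  have e := cm_eq d u
  have k1 := (hd.au u).comm (hd.fix_r hdiv u)
  have k2 := (hd.au u).comm (hd.fix_l hdiv u)
  have hz : Rt (a * (d * d)) = Rt d * Rt a * Rt d := by
    rw [Rt_bol, hd a, ralt]
  have w1 : Rt u * Rt d * Rt u = Rt u * Rt u * Rt d * cm d u := by
    simp only [mul_assoc, e, ← k1, ← k2, asc k1.symm, asc k2.symm]
  have w2 : Rt d * (Rt u * Rt d * Rt u) = Rt u * Rt u * Rt d * Rt d * (cm d u * cm d u * cm d u) := by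
    simp only [mul_assoc, e, asc e, ← k1, ← k2, asc k1.symm, asc k2.symm]
  have v1 : d * (u * u) = (u * d) * u := by
    have := congrArg (fun f : Equiv.Perm Q => f 1) w1
    simp only [Equiv.Perm.mul_apply, (hd.au u).map_one, Rt_one_app] at this
    rw [← ralt]
    exact this.symm
  have v2 : Rt d (Rt a ((u * d) * u)) = (Rt u * Rt u * Rt d * Rt d) a := by
    have : Rt a ((u * d) * u) = (Rt u * Rt d * Rt u) a := by
      rw [Rt_bol]; exact (ha _).symm
    rw [this, ← Equiv.Perm.mul_apply, w2]
    simp only [Equiv.Perm.mul_apply]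
    rw [cube2 hdiv ha hd]
  have v3 : (u * u) * (a * (d * d)) = Rt d (Rt a ((u * d) * u)) := by
    rw [← v1]
    change Rt (a * (d * d)) (u * u) = _
    rw [hz, hd (u * u)]; rfl
  rw [v3, v2, Rt_sq, mul_assoc, Rt_sq]; rfl

/-- coset preserving maps -/
def Cos (f : Equiv.Perm Q) : Prop := ∀ c x : Q, C c → ∃ c', C c' ∧ f (c * x) = c' * f x

theorem Cos.mul {f g : Equiv.Perm Q} (hf : Cos f) (hg : Cos g) : Cos (f * g) := by
  intro c x hc
  obtain ⟨c1, h1, e1⟩ := hg c x hc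
  obtain ⟨c2, h2, e2⟩ := hf c1 (g x) h1
  exact ⟨c2, h2, by rw [Equiv.Perm.mul_apply, e1, e2]; rfl⟩

theorem Cos_Rt (y : Q) : Cos (Rt y) := by
  intro c x hc
  have T := (Tr_Rt_inv (x * y)).mul ((Tr_Rt y).mul (Tr_Rt x))
  have h := T.au (by
    rw [Equiv.Perm.mul_apply, Equiv.Perm.mul_apply, Equiv.Perm.inv_eq_iff_eq, Rt_one_app,
      Rt_one_app]; rfl)
  refine ⟨_, hc.map h, ?_⟩
  change _ = Rt (x * y) (((Rt (x * y))⁻¹ * (Rt y * Rt x)) c)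
  rw [← Equiv.Perm.mul_apply, mul_inv_cancel_left]; rfl

theorem Cos_Rt_inv (y : Q) : Cos (Rt y)⁻¹ := by
  rw [← Rt_inv]; exact Cos_Rt _

theorem Cos_Lt (hdiv : Function.Bijective fun x : Q => x * x) (y : Q) : Cos (Lt y) := by
  intro c x hc
  obtain ⟨d, rfl⟩ := hdiv.2 c
  have hd : C d := C.root hdiv hc
  show ∃ c', C c' ∧ y * ((d * d) * x) = c' * (y * x)
  have e1 : y * ((d * d) * x) = (Rt d * Rt x) (d * y) := by
    rw [hc x, ← ralt, ← hd x, ← bol, hd y]; rfl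
  obtain ⟨c', hc', e2⟩ := (Cos_Rt d).mul (Cos_Rt x) d y hd
  have e3 : (Rt d * Rt x) y = d * (y * x) := (hd _).symm
  obtain ⟨c2, hc2, e4⟩ := Cos_Rt_inv (y * x) c' (d * (y * x)) hc'
  have e5 : (Rt (y * x))⁻¹ (d * (y * x)) = d := by
    rw [Equiv.Perm.inv_eq_iff_eq]; rfl
  rw [e5, Equiv.Perm.inv_eq_iff_eq] at e4
  exact ⟨c2 * d, hc2.mul hdiv hd, by rw [e1, e2, e3, e4]; rfl⟩

theorem Lt_inv (y : Q) : (Lt y)⁻¹ = (Rt y)⁻¹ * Lt y⁻¹ * Rt y := by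
  have : Lt y⁻¹ * Rt y * Lt y = Rt y := by
    ext z
    change y⁻¹ * ((y * z) * y) = z * y
    rw [← bol, BruckLoop.inv_mul, LoopStr.one_mul]
  symm
  apply eq_inv_of_mul_eq_one_left
  rw [mul_assoc, mul_assoc, ← mul_assoc (Lt y⁻¹), this, inv_mul_cancel]

theorem Cos_mlt (hdiv : Function.Bijective fun x : Q => x * x) {f : Equiv.Perm Q}
    (hf : f ∈ Mlt Q) : Cos f ∧ Cos f⁻¹ := by
  induction hf using Subgroup.closure_induction with
  | mem f hf =>
    obtain ⟨a, rfl | rfl⟩ := hf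
    · exact ⟨Cos_Rt a, Cos_Rt_inv a⟩
    · refine ⟨Cos_Lt hdiv a, ?_⟩
      rw [Lt_inv]
      exact ((Cos_Rt_inv a).mul (Cos_Lt hdiv _)).mul (Cos_Rt a)
  | one =>
    rw [_root_.inv_one]
    exact ⟨fun c x hc => ⟨c, hc, rfl⟩, fun c x hc => ⟨c, hc, rfl⟩⟩
  | mul f g _ _ hf hg =>
    rw [_root_.mul_inv_rev]
    exact ⟨hf.1.mul hg.1, hg.2.mul hf.2⟩
  | inv f _ hf =>
    rw [_root_.inv_inv]
    exact ⟨hf.2, hf.1⟩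

theorem one_C : C (1 : Q) := fun x => by rw [LoopStr.one_mul, LoopStr.mul_one]

end BruckAux

/-- In a uniquely 2-divisible Bruck loop, the commutant is a normal subloop. -/
theorem bruck_commutant_isNormalSubloop {Q : Type*} [BruckLoop Q]
    (hdiv : Function.Bijective fun x : Q => x * x) :
    IsNormalSubloop {a : Q | ∀ x : Q, a * x = x * a} := by
  have hR : ∀ a ∈ {a : Q | ∀ x : Q, a * x = x * a}, ∀ b ∈ {a : Q | ∀ x : Q, a * x = x * a},
      ∀ x : Q, x * a = b → x ∈ {a : Q | ∀ x : Q, a * x = x * a} := by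
    intro a ha b hb x h
    have e : x = b * a⁻¹ := by rw [← h, BruckAux.rip]
    rw [e]
    exact BruckAux.C.mul hdiv hb (BruckAux.C.inv ha)
  refine ⟨⟨BruckAux.one_C, fun a ha b hb => BruckAux.C.mul hdiv ha hb, ?_, hR⟩, ?_⟩
  · intro a ha b hb x h
    exact hR a ha b hb x (by rw [← h]; exact (ha x).symm)
  · intro f hf h1 a ha
    obtain ⟨c, hc, e⟩ := (BruckAux.Cos_mlt hdiv hf).1 a 1 ha
    rw [LoopStr.mul_one, h1, LoopStr.mul_one] at e
    rw [e]
    exact hc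
end

section
/- If T is a Tarski monster group, then the automorphism group Aut(T) contains no element of order 2. -/
/-- A Tarski monster: an infinite group in which every nontrivial proper
subgroup is cyclic of order the fixed prime `p`. -/
def IsTarskiMonster (G : Type*) [Group G] (p : ℕ) : Prop :=
  p.Prime ∧ Infinite G ∧
    ∀ H : Subgroup G, H ≠ ⊥ → H ≠ ⊤ → Nat.card H = p ∧ IsCyclic H

namespace TarskiAux

variable {G : Type*} [Group G] {p : ℕ}

theorem finite_of_ne_top (h : IsTarskiMonster G p) (H : Subgroup G) (hH : H ≠ ⊤) :
    (H : Set G).Finite := by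
  by_cases hb : H = ⊥
  · subst hb; simp
  · have := (h.2.2 H hb hH).1
    have : Finite H := Nat.finite_of_card_ne_zero (by rw [this]; exact h.1.ne_zero)
    exact Set.toFinite _

theorem ne_top_of_finite (h : IsTarskiMonster G p) (H : Subgroup G) (hH : (H : Set G).Finite) :
    H ≠ ⊤ := by
  rintro rfl
  have := h.2.1
  exact Set.infinite_univ (by simpa using hH)

theorem zpowers_ne_top (h : IsTarskiMonster G p) (x : G) : Subgroup.zpowers x ≠ ⊤ := by
  intro hx
  have hfo : ¬ IsOfFinOrder x := by
    intro hf
    exact ne_top_of_finite h _ (finite_zpowers.2 hf) hx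
  have hinj := injective_zpow_iff_not_isOfFinOrder.2 hfo
  have h2 : ¬ IsOfFinOrder (x ^ 2) := by
    intro h'
    exact hfo ((isOfFinOrder_pow.1 h').resolve_right (by norm_num))
  have htop : Subgroup.zpowers (x ^ 2) = ⊤ := by
    by_contra hne
    exact h2 (finite_zpowers.1 (finite_of_ne_top h _ hne))
  have hm : x ∈ Subgroup.zpowers (x ^ 2) := htop ▸ Subgroup.mem_top x
  obtain ⟨k, hk⟩ := Subgroup.mem_zpowers_iff.1 hm
  have : x ^ (2 * k) = x ^ (1 : ℤ) := by
    rw [zpow_mul, zpow_one]; exact_mod_cast hk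
  have := hinj this
  omega

theorem pow_p (h : IsTarskiMonster G p) (x : G) : x ^ p = 1 := by
  by_cases hx : x = 1
  · simp [hx]
  · have := (h.2.2 (Subgroup.zpowers x) (by simpa using hx) (zpowers_ne_top h x)).1
    rw [Nat.card_zpowers] at this
    rw [← this, pow_orderOf_eq_one]

theorem not_central (h : IsTarskiMonster G p) (u : G) (hu : u ≠ 1) : ∃ g, g * u ≠ u * g := by
  by_contra! hc
  have hn : (Subgroup.zpowers u).Normal := by
    refine ⟨fun n hn g => ?_⟩
    obtain ⟨k, rfl⟩ := Subgroup.mem_zpowers_iff.1 hn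
    have : Commute g (u ^ k) := (show Commute g u from hc g).zpow_right k
    rw [this.eq]; simpa using hn
  have hfin : ∀ x : G, (Subgroup.zpowers x : Set G).Finite :=
    fun x => finite_of_ne_top h _ (zpowers_ne_top h x)
  obtain ⟨y, hy⟩ : ∃ y, y ∉ Subgroup.zpowers u := by
    by_contra! hh
    exact zpowers_ne_top h u ((Subgroup.eq_top_iff' _).2 hh)
  have hS : ((Subgroup.zpowers y ⊔ Subgroup.zpowers u : Subgroup G) : Set G).Finite := by
    rw [Subgroup.mul_normal]
    exact (hfin y).mul (hfin u)
  have hne := ne_top_of_finite h _ hS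
  have hub : Subgroup.zpowers u ≠ ⊥ := by simpa using hu
  have c1 := (h.2.2 _ hub (zpowers_ne_top h u)).1
  have hle : Subgroup.zpowers u ≤ Subgroup.zpowers y ⊔ Subgroup.zpowers u := le_sup_right
  have c2 := (h.2.2 (Subgroup.zpowers y ⊔ Subgroup.zpowers u)
    (fun hb => hub (le_bot_iff.1 (hb ▸ hle))) hne).1
  have : Finite (Subgroup.zpowers y ⊔ Subgroup.zpowers u : Subgroup G) := hS
  have heq := Subgroup.eq_of_le_of_card_ge hle (by rw [c1, c2])
  apply hy
  rw [heq]
  exact (le_sup_left : Subgroup.zpowers y ≤ _) (Subgroup.mem_zpowers y)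

theorem finite_conj (h : IsTarskiMonster G p) (t w : G) (ht : t ≠ 1) :
    {a : G | a * t * a⁻¹ = w}.Finite := by
  rcases Set.eq_empty_or_nonempty {a : G | a * t * a⁻¹ = w} with he | ⟨a0, h0⟩
  · rw [he]; exact Set.finite_empty
  · have hC : Subgroup.centralizer {t} ≠ ⊤ := by
      intro hC
      obtain ⟨g, hg⟩ := not_central h t ht
      have : g ∈ Subgroup.centralizer {t} := hC ▸ Subgroup.mem_top g
      rw [Subgroup.mem_centralizer_singleton_iff] at this
      first | exact hg this | exact hg this.symm
    refine ((finite_of_ne_top h _ hC).image (fun z => a0 * z)).subset ?_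
    intro a ha
    refine ⟨a0⁻¹ * a, ?_, by simp⟩
    simp only [Set.mem_setOf_eq] at ha h0
    rw [SetLike.mem_coe, Subgroup.mem_centralizer_singleton_iff]
    have e : a * t * a⁻¹ = a0 * t * a0⁻¹ := ha.trans h0.symm
    have e2 : a * t = a0 * t * a0⁻¹ * a := by rw [← e]; group
    have e3 : a0⁻¹ * a * t = t * (a0⁻¹ * a) := by rw [mul_assoc, e2]; group
    first | exact e3 | exact e3.symm

theorem p_odd (h : IsTarskiMonster G p) : Odd p := by
  refine h.1.odd_of_ne_two ?_
  rintro rfl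
  have := h.2.1
  obtain ⟨u, hu⟩ := exists_ne (1 : G)
  obtain ⟨g, hg⟩ := not_central h u hu
  have hi : ∀ x : G, x⁻¹ = x := fun x => by
    have := pow_p h x
    rw [pow_two] at this
    exact inv_eq_of_mul_eq_one_left this
  apply hg
  rw [← hi (g * u), mul_inv_rev, hi, hi]

end TarskiAux

open TarskiAux in
/-- The automorphism group of a Tarski monster contains no element of order 2. -/
theorem tarskiMonster_aut_no_involution {G : Type*} [Group G] {p : ℕ}
    (h : IsTarskiMonster G p) :
    ∀ τ : MulAut G, orderOf τ ≠ 2 := by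
  intro τ hτ
  have hinf := h.2.1
  have hττ : ∀ x, τ (τ x) = x := fun x => by
    have := pow_orderOf_eq_one τ
    rw [hτ, pow_two] at this
    rw [← MulAut.mul_apply, this, MulAut.one_apply]
  obtain ⟨x, hx⟩ : ∃ x, τ x ≠ x := by
    by_contra! hh
    have : τ = 1 := MulEquiv.ext hh
    simp [this] at hτ
  let C : Subgroup G :=
    { carrier := {g | τ g = g}
      mul_mem' := by
        intro a b ha hb
        simp only [Set.mem_setOf_eq] at *
        rw [map_mul, ha, hb]
      one_mem' := by simp
      inv_mem' := by
        intro a ha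
        simp only [Set.mem_setOf_eq] at *
        rw [map_inv, ha] }
  have hCtop : C ≠ ⊤ := fun hC => hx (show x ∈ C from hC ▸ Subgroup.mem_top x)
  have hCfin := finite_of_ne_top h C hCtop
  let I : Set G := {a | τ a = a⁻¹}
  obtain ⟨m, hm⟩ := p_odd h
  -- every element is a product of a fixed element and an inverted element
  have hdec : ∀ g : G, ∃ c ∈ C, c⁻¹ * g ∈ I := by
    intro g
    set a := g⁻¹ * τ g with ha
    have hta : τ a = a⁻¹ := by rw [ha, map_mul, map_inv, hττ]; group
    set b := a ^ (m + 1) with hb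
    have htb : τ b = b⁻¹ := by rw [hb, map_pow, hta, inv_pow]
    have hbb : b * b = a := by
      have := pow_p h a
      rw [hb, ← pow_add, show m + 1 + (m + 1) = p + 1 by omega, pow_succ, this, one_mul]
    refine ⟨g * b, ?_, ?_⟩
    · change τ (g * b) = g * b
      have hg : τ g = g * a := by rw [ha]; group
      rw [map_mul, htb, hg, ← hbb]; group
    · change τ _ = _
      have : (g * b)⁻¹ * g = b⁻¹ := by group
      rw [this, map_inv, htb]
  have hIinf : ¬ I.Finite := by
    intro hI
    refine Set.infinite_univ ((hCfin.mul hI).subset ?_ : (Set.univ : Set G).Finite)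
    intro g _
    obtain ⟨c, hc, hi⟩ := hdec g
    exact Set.mem_mul.2 ⟨c, hc, _, hi, by group⟩
  apply hIinf
  refine (Set.Finite.biUnion hCfin (t := fun c => {a | a * τ (c⁻¹ * x) * a⁻¹ = (c⁻¹ * x)⁻¹})
    ?_).subset ?_
  · intro c hc
    apply finite_conj h
    intro h1
    have : c⁻¹ * x = 1 := by simpa only [map_eq_one_iff τ τ.injective] using h1
    have : x = c := (inv_mul_eq_one.1 this).symm
    exact hx (this ▸ hc)
  · intro a ha
    obtain ⟨c, hc, hi⟩ := hdec (x * a)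
    refine Set.mem_biUnion hc ?_
    change a * τ (c⁻¹ * x) * a⁻¹ = (c⁻¹ * x)⁻¹
    have hi' : τ (c⁻¹ * (x * a)) = (c⁻¹ * (x * a))⁻¹ := hi
    have ha' : τ a = a⁻¹ := ha
    rw [← mul_assoc, map_mul, ha', mul_inv_rev] at hi'
    rw [mul_assoc, hi']; group
end

section
/- Let T be a Tarski monster group (which is uniquely 2-divisible since every element has odd prime order p with p odd). Then the Bruck loop T(1/2) with operation x ⊙ y = (y x² y)^{1/2} is a Bruck-Tarski monster: it is infinite and every nontrivial proper subloop is cyclic of order p. -/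
/-- Natural powers in a magma with unit `e`, by iterated right multiplication. -/
def lpow {G : Type*} (o : G → G → G) (e : G) (x : G) : ℕ → G
  | 0 => e
  | n + 1 => o (lpow o e x n) x

/-- Integer powers in a magma with unit `e` and inversion `inv`. -/
def lzpow {G : Type*} (o : G → G → G) (e : G) (inv : G → G) (x : G) : ℤ → G
  | Int.ofNat n => lpow o e x n
  | Int.negSucc n => lpow o e (inv x) (n + 1)

/-- A subloop of the magma `(G, ⊙)`: contains `1`, closed under `⊙` and under
both divisions. -/
def IsSubloopUnder {G : Type*} (o : G → G → G) (e : G) (S : Set G) : Prop :=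
  e ∈ S ∧ (∀ a ∈ S, ∀ b ∈ S, o a b ∈ S) ∧
  (∀ a ∈ S, ∀ b ∈ S, ∀ x, o a x = b → x ∈ S) ∧
  (∀ a ∈ S, ∀ b ∈ S, ∀ x, o x a = b → x ∈ S)

namespace IsTarskiMonster

variable {G : Type*} [Group G] {p : ℕ}

theorem finite_of_ne_top (h : IsTarskiMonster G p) (H : Subgroup G) (hH : H ≠ ⊤) : Finite H := by
  by_cases hb : H = ⊥
  · subst hb; infer_instance
  · exact Nat.finite_of_card_ne_zero (by rw [(h.2.2 H hb hH).1]; exact h.1.ne_zero)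

theorem orderOf_eq (h : IsTarskiMonster G p) (x : G) (hx : x ≠ 1) : orderOf x = p := by
  have hb : Subgroup.zpowers x ≠ ⊥ := by simpa using hx
  by_cases ht : Subgroup.zpowers x = ⊤
  · exfalso
    have hinf : Infinite G := h.2.1
    have hnf : ¬ IsOfFinOrder x := by
      intro hf
      have h1 : Finite (Subgroup.zpowers x) := by
        rw [← SetLike.coe_sort_coe]; exact finite_zpowers.2 hf
      rw [ht] at h1
      have : Finite G := Finite.of_equiv _ (Subgroup.topEquiv (G := G)).toEquiv
      exact not_finite G
    have hnf2 : ¬ IsOfFinOrder (x ^ 2) := by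
      intro hf
      exact hnf ((isOfFinOrder_pow.1 hf).resolve_right (by norm_num))
    have h2 : Subgroup.zpowers (x ^ 2) ≠ ⊤ := by
      intro h2
      have : x ∈ Subgroup.zpowers (x ^ 2) := by rw [h2]; trivial
      obtain ⟨n, hn⟩ := Subgroup.mem_zpowers_iff.1 this
      have h3 : x ^ (2 * n) = x ^ (1 : ℤ) := by
        rw [zpow_mul]; simpa using hn
      have := injective_zpow_iff_not_isOfFinOrder.2 hnf h3
      omega
    have h4 := h.finite_of_ne_top _ h2
    rw [← SetLike.coe_sort_coe] at h4
    exact hnf2 (finite_zpowers.1 h4)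
  · rw [← Nat.card_zpowers]; exact (h.2.2 _ hb ht).1

theorem pow_p (h : IsTarskiMonster G p) (x : G) : x ^ p = 1 := by
  by_cases hx : x = 1
  · simp [hx]
  · rw [← h.orderOf_eq x hx]; exact pow_orderOf_eq_one x

theorem finite_zp (h : IsTarskiMonster G p) (x : G) : (Subgroup.zpowers x : Set G).Finite :=
  finite_zpowers.2 (isOfFinOrder_iff_pow_eq_one.2 ⟨p, h.1.pos, h.pow_p x⟩)

theorem eq_one_of_central (h : IsTarskiMonster G p) (a : G) (ha : ∀ y, y * a = a * y) : a = 1 := by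
  by_contra hne
  have hinf : Infinite G := h.2.1
  obtain ⟨x, hx⟩ := (h.finite_zp a).exists_notMem
  have hN : (Subgroup.zpowers a).Normal := by
    refine ⟨?_⟩
    rintro _ ⟨n, rfl⟩ g
    have : Commute g a := ha g
    have h2 := (this.zpow_right n).eq
    refine ⟨n, ?_⟩
    simp only [h2, mul_inv_cancel_right]
  have hset : ((Subgroup.zpowers x ⊔ Subgroup.zpowers a : Subgroup G) : Set G).Finite := by
    rw [Subgroup.mul_normal]
    exact (h.finite_zp x).mul (h.finite_zp a)
  have htop : Subgroup.zpowers x ⊔ Subgroup.zpowers a ≠ ⊤ := by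
    intro ht
    rw [ht] at hset
    exact Set.infinite_univ (by simpa using hset)
  have hle : Subgroup.zpowers a ≤ Subgroup.zpowers x ⊔ Subgroup.zpowers a := le_sup_right
  have hbot : Subgroup.zpowers x ⊔ Subgroup.zpowers a ≠ ⊥ := by
    intro hb
    rw [hb, le_bot_iff] at hle
    exact hne (by simpa using hle)
  have hcard := (h.2.2 _ hbot htop).1
  have hfin := h.finite_of_ne_top _ htop
  have := Subgroup.eq_of_le_of_card_ge hle (by rw [hcard, Nat.card_zpowers, h.orderOf_eq a hne])
  apply hx
  rw [this]
  exact (le_sup_left : Subgroup.zpowers x ≤ _) (Subgroup.mem_zpowers x)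

theorem eq_one_of_infinite (h : IsTarskiMonster G p) (a b : G)
    (hi : {y : G | y * a * y⁻¹ = b}.Infinite) : a = 1 := by
  apply h.eq_one_of_central
  by_contra hc
  push Not at hc
  obtain ⟨z, hz⟩ := hc
  have ht : Subgroup.centralizer {a} ≠ ⊤ := by
    intro ht
    have : z ∈ Subgroup.centralizer {a} := by rw [ht]; trivial
    rw [Subgroup.mem_centralizer_singleton_iff] at this
    exact hz (by first | exact this | exact this.symm)
  have hf := h.finite_of_ne_top _ ht
  obtain ⟨y₀, hy₀⟩ := hi.nonempty
  have hy₀' : y₀ * a * y₀⁻¹ = b := hy₀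
  apply hi
  have hf' : ((Subgroup.centralizer {a} : Subgroup G) : Set G).Finite := hf
  refine (hf'.image (fun c => y₀ * c)).subset ?_
  intro y hy
  have hy' : y * a * y⁻¹ = b := hy
  refine ⟨y₀⁻¹ * y, ?_, by simp⟩
  rw [SetLike.mem_coe, Subgroup.mem_centralizer_singleton_iff]
  have h1 : y * a = b * y := by rw [← hy']; group
  have h2 : a * y₀⁻¹ = y₀⁻¹ * b := by rw [← hy₀']; group
  have h3 : y₀⁻¹ * y * a = a * (y₀⁻¹ * y) := by
    rw [mul_assoc, h1, ← mul_assoc, ← h2, mul_assoc]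
  first | exact h3 | exact h3.symm

theorem normal_eq_bot (h : IsTarskiMonster G p) (N : Subgroup G) (hN : N.Normal)
    (ht : N ≠ ⊤) : N = ⊥ := by
  rw [Subgroup.eq_bot_iff_forall]
  intro n hn
  have hinf : Infinite G := h.2.1
  have hf := h.finite_of_ne_top N ht
  obtain ⟨b, hb⟩ := Finite.exists_infinite_fiber
    (fun y : G => (⟨y * n * y⁻¹, hN.conj_mem n hn y⟩ : N))
  apply h.eq_one_of_infinite n b.1
  rw [← Set.infinite_coe_iff]
  have : {y : G | y * n * y⁻¹ = b.1} =
      (fun y : G => (⟨y * n * y⁻¹, hN.conj_mem n hn y⟩ : N)) ⁻¹' {b} := by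
    ext y; simp [Subtype.ext_iff]
  rw [this]; exact hb

theorem sq_inj (h : IsTarskiMonster G p) (hodd : Odd p) {x y : G} (hxy : x * x = y * y) :
    x = y := by
  obtain ⟨m, hm⟩ := hodd
  have key : ∀ z : G, (z * z) ^ (m + 1) = z := by
    intro z
    rw [← pow_two, ← pow_mul, show 2 * (m + 1) = p + 1 by omega, pow_succ, h.pow_p, one_mul]
  rw [← key x, hxy, key y]

theorem exists_sqrt (h : IsTarskiMonster G p) (hodd : Odd p) (x : G) : ∃ r : G, r * r = x := by
  obtain ⟨m, hm⟩ := hodd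
  refine ⟨x ^ (m + 1), ?_⟩
  rw [← pow_add, show m + 1 + (m + 1) = p + 1 by omega, pow_succ, h.pow_p, one_mul]

/-- A Tarski monster (`p` odd) has no involutory automorphism. -/
theorem no_involution (h : IsTarskiMonster G p) (hodd : Odd p) (τ : G →* G)
    (hτ : ∀ x, τ (τ x) = x) (x : G) : τ x = x := by
  by_contra hx
  have hinf : Infinite G := h.2.1
  let C : Subgroup G := τ.eqLocus (MonoidHom.id G)
  have hC : C ≠ ⊤ := by
    intro ht
    have : x ∈ C := by rw [ht]; trivial
    exact hx this
  have hfin : Finite C := h.finite_of_ne_top C hC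
  have dec : ∀ g : G, ∃ c : C, τ (c.1⁻¹ * g) = (c.1⁻¹ * g)⁻¹ := by
    intro g
    obtain ⟨r, hr⟩ := h.exists_sqrt hodd (g⁻¹ * τ g)
    have hr' : τ r = r⁻¹ := by
      apply h.sq_inj hodd
      rw [← map_mul, hr, ← mul_inv_rev, hr]
      simp [hτ]
    have hg : τ g = g * (r * r) := by rw [hr]; group
    refine ⟨⟨g * r, ?_⟩, ?_⟩
    · change τ (g * r) = g * r
      rw [map_mul, hr', hg]; group
    · simp [hr', hg]
  choose c hc using dec
  let e : ℕ ↪ G := Infinite.natEmbedding G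
  obtain ⟨q, hq⟩ := Finite.exists_infinite_fiber
    (fun x : G => fun i : Fin (Nat.card C + 1) => c (x * e i))
  have hij : ∃ i j, i ≠ j ∧ q i = q j := by
    have := Fintype.ofFinite C
    apply Fintype.exists_ne_map_eq_of_card_lt q
    rw [← Nat.card_eq_fintype_card, Fintype.card_fin]; omega
  obtain ⟨i, j, hne, hqe⟩ := hij
  have h1 : e i * (e j)⁻¹ = 1 := by
    apply h.eq_one_of_infinite _ (τ ((e i)⁻¹ * e j))
    rw [Set.infinite_coe_iff] at hq
    have hinj : Function.Injective (fun x : G => (q i).1⁻¹ * x) := mul_right_injective _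
    refine (hq.image hinj.injOn).mono ?_
    rintro _ ⟨y, hy, rfl⟩
    have hy' : (fun i : Fin (Nat.card C + 1) => c (y * e i)) = q := hy
    have hi := hc (y * e i)
    have hj := hc (y * e j)
    rw [show c (y * e i) = q i from congrFun hy' i, ← mul_assoc] at hi
    rw [show c (y * e j) = q j from congrFun hy' j, ← hqe, ← mul_assoc] at hj
    change ((q i).1⁻¹ * y) * (e i * (e j)⁻¹) * ((q i).1⁻¹ * y)⁻¹ = _
    generalize (q i).1⁻¹ * y = w at hi hj ⊢
    rw [map_mul] at hi hj
    have hi' : τ (e i) = (τ w)⁻¹ * (w * e i)⁻¹ := by rw [← hi]; group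
    have hj' : τ (e j) = (τ w)⁻¹ * (w * e j)⁻¹ := by rw [← hj]; group
    rw [map_mul, map_inv, hi', hj']; group
  have h2 : e i = e j := by rwa [mul_inv_eq_one] at h1
  exact hne (Fin.ext (e.injective h2))

/-- A twisted subgroup generating a Tarski monster is trivial or everything. -/
theorem twisted (h : IsTarskiMonster G p) (hodd : Odd p) (S : Set G) (h1 : 1 ∈ S)
    (hinv : ∀ x ∈ S, x⁻¹ ∈ S) (htw : ∀ x ∈ S, ∀ y ∈ S, y * x * y ∈ S)
    (hgen : Subgroup.closure S = ⊤) (hS : S ≠ {1}) : S = Set.univ := by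
  let K : Subgroup (G × G) := Subgroup.closure ((fun x : G => (x, x⁻¹)) '' S)
  have hgenK : ∀ x ∈ S, (x, x⁻¹) ∈ K := fun x hx => Subgroup.subset_closure ⟨x, hx, rfl⟩
  have hact : ∀ q ∈ K, ∀ s, s ∈ S ↔ q.1 * s * q.2⁻¹ ∈ S := by
    intro q hq
    induction hq using Subgroup.closure_induction with
    | mem q hq =>
      obtain ⟨x, hx, rfl⟩ := hq
      intro s
      simp only [inv_inv]
      refine ⟨fun hs => htw s hs x hx, fun hs => ?_⟩
      have := htw _ hs _ (hinv x hx)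
      simpa [mul_assoc] using this
    | one => simp
    | mul a b _ _ ha hb =>
      intro s
      rw [hb s, ha]
      simp [mul_assoc]
    | inv a _ ha =>
      intro s
      rw [ha (a⁻¹.1 * s * a⁻¹.2⁻¹)]
      simp [mul_assoc]
  have hswap : ∀ q ∈ K, (q.2, q.1) ∈ K := by
    intro q hq
    induction hq using Subgroup.closure_induction with
    | mem q hq =>
      obtain ⟨x, hx, rfl⟩ := hq
      simpa using hgenK _ (hinv x hx)
    | one => exact K.one_mem
    | mul a b _ _ ha hb => exact K.mul_mem ha hb
    | inv a _ ha => exact K.inv_mem ha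
  have hsurj : ∀ g : G, ∃ b, (g, b) ∈ K := by
    intro g
    have hg : g ∈ Subgroup.closure S := by rw [hgen]; trivial
    induction hg using Subgroup.closure_induction with
    | mem x hx => exact ⟨_, hgenK x hx⟩
    | one => exact ⟨1, K.one_mem⟩
    | mul a b _ _ ha hb =>
      obtain ⟨a', ha⟩ := ha
      obtain ⟨b', hb⟩ := hb
      exact ⟨a' * b', K.mul_mem ha hb⟩
    | inv a _ ha =>
      obtain ⟨a', ha⟩ := ha
      exact ⟨a'⁻¹, K.inv_mem ha⟩
  let R : Subgroup G := K.comap (MonoidHom.inl G G)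
  have hR : R.Normal := by
    refine ⟨fun n hn g => ?_⟩
    obtain ⟨b, hb⟩ := hsurj g
    have hn' : (n, (1 : G)) ∈ K := hn
    have := K.mul_mem (K.mul_mem hb hn') (K.inv_mem hb)
    change (g * n * g⁻¹, (1 : G)) ∈ K
    simpa using this
  by_cases hT : R = ⊤
  · ext g
    simp only [Set.mem_univ, iff_true]
    have hg : g ∈ R := by rw [hT]; trivial
    have hg' : (g, (1 : G)) ∈ K := hg
    simpa using (hact _ hg' 1).1 h1
  · exfalso
    have hbot := h.normal_eq_bot R hR hT
    have huniq : ∀ g a b, (g, a) ∈ K → (g, b) ∈ K → a = b := by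
      intro g a b ha hb
      have h2 := hswap _ (K.mul_mem (K.inv_mem ha) hb)
      have h3 : a⁻¹ * b ∈ R := by
        change (a⁻¹ * b, (1 : G)) ∈ K
        simpa using h2
      rw [hbot, Subgroup.mem_bot] at h3
      exact inv_mul_eq_one.1 h3
    choose t ht using hsurj
    let τ : G →* G := MonoidHom.mk' t (fun a b => huniq _ _ _ (ht _) (K.mul_mem (ht a) (ht b)))
    have hτ : ∀ x, τ x = x := h.no_involution hodd τ
      (fun x => huniq _ _ _ (ht _) (hswap _ (ht x)))
    apply hS
    ext x
    simp only [Set.mem_singleton_iff]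
    refine ⟨fun hx => ?_, fun hx => hx ▸ h1⟩
    have h4 : t x = x⁻¹ := huniq _ _ _ (ht x) (hgenK x hx)
    have h5 : t x = x := hτ x
    rw [h5] at h4
    apply h.sq_inj hodd
    rw [one_mul]
    nth_rw 1 [h4]
    simp

end IsTarskiMonster

/-- If `T` is a Tarski monster for an odd prime `p`, then `T` is uniquely
2-divisible, and the Bruck loop `T(1/2)` with `x ⊙ y = (y x² y)^{1/2}` is a
Bruck–Tarski monster: an infinite Bruck loop all of whose nontrivial proper
subloops are cyclic of order `p`. -/
theorem tarskiMonster_halving_isBruckTarskiMonster {G : Type*} [Group G] {p : ℕ}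
    (h : IsTarskiMonster G p) (hodd : Odd p) :
    ∃ s : G → G, (∀ x : G, s x * s x = x) ∧ (∀ x y : G, y * y = x → y = s x) ∧
      ∀ o : G → G → G, (∀ x y : G, o x y = s (y * (x * x) * y)) →
        -- (G, ⊙) is a Bruck loop: right Bol identity and AIP
        (∀ x y z : G, o (o (o x y) z) y = o x (o (o y z) y)) ∧
        (∀ x y : G, (o x y)⁻¹ = o x⁻¹ y⁻¹) ∧
        -- it is infinite
        Infinite G ∧
        -- every nontrivial proper subloop is cyclic of order p
        ∀ S : Set G, IsSubloopUnder o 1 S → S ≠ {1} → S ≠ Set.univ →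
          (∃ x : G, S = Set.range fun n : ℕ => lpow o 1 x n) ∧ S.ncard = p := by
  classical
  choose s hs using h.exists_sqrt hodd
  refine ⟨s, hs, fun x y hy => h.sq_inj hodd (by rw [hy, hs]), ?_⟩
  intro o ho
  have hsq : ∀ x y, o x y * o x y = y * (x * x) * y := fun x y => by rw [ho, hs]
  refine ⟨?_, ?_, h.2.1, ?_⟩
  · intro x y z
    have hw : o (o y z) y = y * z * y := by
      apply h.sq_inj hodd
      rw [hsq, hsq]; group
    apply h.sq_inj hodd
    rw [hw, hsq, hsq, hsq, hsq]; group
  · intro x y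
    apply h.sq_inj hodd
    rw [hsq, ← mul_inv_rev, hsq]; group
  · intro S hS hS1 hSu
    obtain ⟨h1, hmul, -, -⟩ := hS
    have hpow : ∀ x n, lpow o 1 x n = x ^ n := by
      intro x n
      induction n with
      | zero => simp [lpow]
      | succ n ih =>
        rw [lpow, ih]
        apply h.sq_inj hodd
        rw [hsq]
        simp only [← pow_succ, ← pow_succ', ← pow_add]
        congr 1; omega
    have hpS : ∀ x ∈ S, ∀ n : ℕ, x ^ n ∈ S := by
      intro x hx n
      rw [← hpow]
      induction n with
      | zero => exact h1
      | succ n ih => exact hmul _ ih _ hx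
    have hinv : ∀ x ∈ S, x⁻¹ ∈ S := by
      intro x hx
      have : x⁻¹ = x ^ (p - 1) := by
        rw [inv_eq_iff_mul_eq_one, ← pow_succ', Nat.sub_add_cancel h.1.pos, h.pow_p]
      rw [this]; exact hpS x hx _
    have htw : ∀ x ∈ S, ∀ y ∈ S, y * x * y ∈ S := by
      intro x hx y hy
      obtain ⟨m, hm⟩ := id hodd
      have hr : x ^ (m + 1) * x ^ (m + 1) = x := by
        rw [← pow_add, show m + 1 + (m + 1) = p + 1 by omega, pow_succ, h.pow_p, one_mul]
      have h2 := hpS _ (hmul _ (hpS x hx (m + 1)) y hy) 2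
      rwa [pow_two, hsq, hr] at h2
    have hnt : Subgroup.closure S ≠ ⊤ := fun ht =>
      hSu (h.twisted hodd S h1 hinv htw ht hS1)
    obtain ⟨x, hx, hx1⟩ : ∃ x ∈ S, x ≠ 1 := by
      by_contra hc
      push Not at hc
      exact hS1 (Set.eq_singleton_iff_unique_mem.2 ⟨h1, hc⟩)
    have hle : Subgroup.zpowers x ≤ Subgroup.closure S :=
      Subgroup.zpowers_le.2 (Subgroup.subset_closure hx)
    have hnb : Subgroup.closure S ≠ ⊥ := by
      intro hb
      rw [hb, le_bot_iff] at hle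
      exact hx1 (by simpa using hle)
    have hcard := (h.2.2 _ hnb hnt).1
    have hfin := h.finite_of_ne_top _ hnt
    have heq := Subgroup.eq_of_le_of_card_ge hle
      (by rw [hcard, Nat.card_zpowers, h.orderOf_eq x hx1])
    have hfo : IsOfFinOrder x := isOfFinOrder_iff_pow_eq_one.2 ⟨p, h.1.pos, h.pow_p x⟩
    have hSr : S = Set.range fun n : ℕ => lpow o 1 x n := by
      ext y
      constructor
      · intro hy
        have : y ∈ Subgroup.zpowers x := by rw [heq]; exact Subgroup.subset_closure hy
        rw [← hfo.mem_powers_iff_mem_zpowers] at this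
        obtain ⟨n, hn⟩ := this
        exact ⟨n, by simpa [hpow] using hn⟩
      · rintro ⟨n, rfl⟩
        simp only [hpow]
        exact hpS x hx n
    refine ⟨⟨x, hSr⟩, ?_⟩
    have hSz : S = (Subgroup.zpowers x : Set G) := by
      ext y
      rw [hSr, SetLike.mem_coe, ← hfo.mem_powers_iff_mem_zpowers]
      simp [hpow, Submonoid.mem_powers_iff]
    rw [hSz, ← Nat.card_coe_set_eq]
    exact (Nat.card_zpowers x).trans (h.orderOf_eq x hx1)
end
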